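/- arXiv:2205.05791 — 4 statements merged into one kernel-verified Lean document; each statement's English description precedes it below -/
import Mathlib

section
/- Let f ∈ ℂ[z₁,…,zₙ] (n ≥ 2) be a non-degenerate homogeneous polynomial of degree n, i.e. the origin is the only common zero in ℂⁿ of the partial derivatives ∂f/∂z₁,…,∂f/∂zₙ. Then every homogeneous polynomial φ ∈ ℂ[z₁,…,zₙ] of degree at least n(n−2)+1 lies in the Jacobian ideal ⟨∂f/∂z₁,…,∂f/∂zₙ⟩ of ℂ[z₁,…,zₙ]. -/
set_option autoImplicit false

open MvPolynomial

section

variable {σ R : Type*} [CommRing R]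

theorem Matrix.det_mul_mem_span_range_mulVec [Fintype σ] [DecidableEq σ] (A : Matrix σ σ R)
    (v : σ → R) (j : σ) : A.det * v j ∈ Ideal.span (Set.range (A.mulVec v)) := by
  have h : A.det * v j = (A.adjugate.mulVec (A.mulVec v)) j := by
    rw [Matrix.mulVec_mulVec, Matrix.adjugate_mul, Matrix.smul_mulVec, Matrix.one_mulVec]
    rfl
  rw [h]
  exact Ideal.sum_mem _ fun i _ =>
    Ideal.mul_mem_left _ _ (Ideal.subset_span (Set.mem_range_self i))

namespace MvPolynomial

theorem mem_span_X_pow_iff {s : Set σ} {N : ℕ} {p : MvPolynomial σ R} :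
    p ∈ Ideal.span ((fun i => (X i ^ N : MvPolynomial σ R)) '' s) ↔
      ∀ m ∈ p.support, ∃ i ∈ s, N ≤ m i := by
  have h := @mem_ideal_span_monomial_image σ R _ p ((fun i => Finsupp.single i N) '' s)
  rw [Set.image_image] at h
  simpa [X_pow_eq_monomial] using h

theorem mem_span_X_pow_of_X_mul_mem {s : Set σ} {N : ℕ}
    {p : MvPolynomial σ R} {i : σ} (hi : i ∉ s)
    (h : X i * p ∈ Ideal.span ((fun j => (X j ^ N : MvPolynomial σ R)) '' s)) :
    p ∈ Ideal.span ((fun j => (X j ^ N : MvPolynomial σ R)) '' s) := by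
  rw [mem_span_X_pow_iff] at h ⊢
  intro m hm
  obtain ⟨j, hj, hN⟩ := h (Finsupp.single i 1 + m) (by
    rw [mem_support_iff, coeff_X_mul]
    exact mem_support_iff.mp hm)
  refine ⟨j, hj, ?_⟩
  have : i ≠ j := fun e => hi (e ▸ hj)
  simpa [Finsupp.single_apply, this] using hN

variable [Fintype σ] [DecidableEq σ]

/-- If the `i`-th row of `F` is a syzygy of the variables and the other rows express the powers
`X k ^ N`, then `det F` lies in the ideal of these powers. -/
theorem det_mem_span_X_pow_of_row_syzygy {N : ℕ}
    (F : Matrix σ σ (MvPolynomial σ R)) (i : σ) (hi : F.mulVec X i = 0)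
    (hF : ∀ k, k ≠ i → F.mulVec X k = X k ^ N) :
    F.det ∈ Ideal.span (Set.range fun k => (X k ^ N : MvPolynomial σ R)) := by
  have h : X i * F.det ∈ Ideal.span ((fun j => (X j ^ N : MvPolynomial σ R)) '' {k | k ≠ i}) := by
    rw [mul_comm]
    refine (Ideal.span_le.mpr ?_) (F.det_mul_mem_span_range_mulVec X i)
    rintro _ ⟨k, rfl⟩
    by_cases hk : k = i
    · subst hk
      rw [hi]
      exact Ideal.zero_mem _
    · rw [hF k hk]
      exact Ideal.subset_span ⟨k, hk, rfl⟩
  exact Ideal.span_mono (Set.image_subset_range _ _) (mem_span_X_pow_of_X_mul_mem (by simp) h)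

theorem det_sub_det_mem_span_X_pow {N : ℕ}
    (E E' : Matrix σ σ (MvPolynomial σ R)) (hE : ∀ k, E.mulVec X k = X k ^ N)
    (hE' : ∀ k, E'.mulVec X k = X k ^ N) :
    E.det - E'.det ∈ Ideal.span (Set.range fun k => (X k ^ N : MvPolynomial σ R)) := by
  let P : Finset σ → Matrix σ σ (MvPolynomial σ R) := fun T k => if k ∈ T then E k else E' k
  have hP : ∀ T k, (P T).mulVec X k = X k ^ N := by
    intro T k
    by_cases hk : k ∈ T
    · simpa [P, Matrix.mulVec, hk] using hE k
    · simpa [P, Matrix.mulVec, hk] using hE' k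
  suffices h : ∀ T, (P T).det - E'.det ∈
      Ideal.span (Set.range fun k => (X k ^ N : MvPolynomial σ R)) by
    have := h Finset.univ
    rwa [show P Finset.univ = E by ext; simp [P]] at this
  intro T
  induction T using Finset.induction_on with
  | empty =>
    rw [show P ∅ = E' by ext; simp [P], sub_self]
    exact Ideal.zero_mem _
  | insert i T hi ih =>
    have h1 : P (insert i T) = (P T).updateRow i (E i - E' i + E' i) := by
      refine _root_.funext fun k => ?_
      by_cases hk : k = i
      · subst hk
        rw [Matrix.updateRow_self]
        simp [P]
      · rw [Matrix.updateRow_ne hk]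
        simp [P, hk]
    have h2 : (P T).updateRow i (E' i) = P T := by
      refine _root_.funext fun k => ?_
      by_cases hk : k = i
      · subst hk
        rw [Matrix.updateRow_self]
        simp [P, hi]
      · rw [Matrix.updateRow_ne hk]
    rw [h1, Matrix.det_updateRow_add, h2, add_sub_assoc]
    refine Ideal.add_mem _ (det_mem_span_X_pow_of_row_syzygy _ i ?_ ?_) ih
    · have e1 := hE i
      have e2 := hE' i
      simp only [Matrix.mulVec] at e1 e2 ⊢
      rw [Matrix.updateRow_self, sub_dotProduct, e1, e2, sub_self]
    · intro k hk
      have := hP T k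
      simp only [Matrix.mulVec] at this ⊢
      rwa [Matrix.updateRow_ne hk]

theorem det_notMem_span_X_pow [Nontrivial R] {N : ℕ} (hN : N ≠ 0)
    (E : Matrix σ σ (MvPolynomial σ R)) (hE : ∀ k, E.mulVec X k = X k ^ N) :
    E.det ∉ Ideal.span (Set.range fun k => (X k ^ N : MvPolynomial σ R)) := by
  intro h
  have h1 := det_sub_det_mem_span_X_pow E (Matrix.diagonal fun k => X k ^ (N - 1)) hE (by
    intro k
    rw [Matrix.mulVec_diagonal, ← pow_succ, Nat.sub_add_cancel (Nat.pos_of_ne_zero hN)])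
  have h2 := (Submodule.sub_mem_iff_right _ h).mp h1
  rw [Matrix.det_diagonal, ← Set.image_univ, mem_span_X_pow_iff] at h2
  have h3 : (∏ k : σ, (X k : MvPolynomial σ R) ^ (N - 1)) =
      monomial (Finsupp.equivFunOnFinite.symm fun _ => N - 1) 1 := by
    rw [monomial_eq, Finsupp.prod_fintype _ _ (by simp)]
    simp
  obtain ⟨i, -, hi⟩ := h2 (Finsupp.equivFunOnFinite.symm fun _ => N - 1) (by simp [h3])
  simp at hi
  omega

theorem det_notMem_span_of_X_pow_mem [Nontrivial R]
    (g : σ → MvPolynomial σ R) (A : Matrix σ σ (MvPolynomial σ R)) (hA : A.mulVec X = g)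
    {N : ℕ} (hN : N ≠ 0) (hX : ∀ i, X i ^ N ∈ Ideal.span (Set.range g)) :
    A.det ∉ Ideal.span (Set.range g) := by
  intro h
  choose D hD using fun i => Ideal.mem_span_range_iff_exists_fun.mp (hX i)
  have hDg : (Matrix.of D).mulVec g = fun i => X i ^ N := _root_.funext hD
  refine det_notMem_span_X_pow hN (Matrix.of D * A) (fun k => ?_) ?_
  · rw [← Matrix.mulVec_mulVec, hA, hDg]
  · rw [Matrix.det_mul, ← hDg]
    obtain ⟨c, hc⟩ := Ideal.mem_span_range_iff_exists_fun.mp h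
    rw [← hc, Finset.mul_sum]
    refine Ideal.sum_mem _ fun i _ => ?_
    rw [mul_left_comm]
    exact Ideal.mul_mem_left _ _ (Matrix.det_mul_mem_span_range_mulVec _ _ _)

end MvPolynomial
end

section

namespace MvPolynomial

variable {σ R : Type*} [CommRing R]

/-- A polynomial difference `g(x) - g(y)`, where the `x`-variables are the coefficients, is a
combination of the differences `x j - y j`. -/
theorem exists_C_sub_map_C_monomial_eq_sum [Fintype σ] (m : σ →₀ ℕ) :
    ∃ b : σ → MvPolynomial σ (MvPolynomial σ R),
      C (monomial m 1) - map C (monomial m 1) = ∑ j, (C (X j) - X j) * b j ∧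
      ∀ j, (map constantCoeff (b j)).IsHomogeneous (m.degree - 1) := by
  classical
  induction m using WellFoundedLT.induction with
  | ind m ih =>
    by_cases hm : m = 0
    · exact ⟨0, by simp [hm], fun j => by simp [isHomogeneous_zero]⟩
    obtain ⟨i, hi⟩ := Finsupp.ne_iff.mp hm
    obtain ⟨m', rfl⟩ : ∃ m', m = Finsupp.single i 1 + m' :=
      exists_add_of_le (Finsupp.single_le_iff.mpr (Nat.one_le_iff_ne_zero.mpr hi))
    obtain ⟨b, hb, -⟩ := ih m' (lt_add_of_pos_left _ (by simp [pos_iff_ne_zero]))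
    refine ⟨fun j => C (X i) * b j + if j = i then map C (monomial m' 1) else 0, ?_, fun j => ?_⟩
    · have h : (monomial (Finsupp.single i 1 + m') 1 : MvPolynomial σ R) =
          X i * monomial m' 1 := by
        rw [X, monomial_mul, one_mul]
      simp_rw [h, mul_add, Finset.sum_add_distrib, mul_left_comm _ (C (X i))]
      rw [← Finset.mul_sum, ← hb]
      simp only [map_mul, map_X, mul_ite, mul_zero, Finset.sum_ite_eq', Finset.mem_univ, if_true]
      ring
    · rw [map_add, map_mul, map_C, constantCoeff_X, C_0, zero_mul, zero_add]
      split_ifs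
      · rw [map_map, map_monomial, map_add, Finsupp.degree_single, Nat.add_sub_cancel_left]
        exact isHomogeneous_monomial _ rfl
      · rw [map_zero]
        exact isHomogeneous_zero _ _ _

theorem exists_C_sub_map_C_eq_sum [Fintype σ] {g : MvPolynomial σ R} {d : ℕ}
    (hg : g.IsHomogeneous d) :
    ∃ b : σ → MvPolynomial σ (MvPolynomial σ R),
      C g - map C g = ∑ j, (C (X j) - X j) * b j ∧
      ∀ j, (map constantCoeff (b j)).IsHomogeneous (d - 1) := by
  choose b hb hb' using exists_C_sub_map_C_monomial_eq_sum (σ := σ) (R := R)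
  refine ⟨fun j => ∑ m ∈ g.support, C (C (g.coeff m)) * b m j, ?_, fun j => ?_⟩
  · simp_rw [Finset.mul_sum]
    rw [Finset.sum_comm]
    conv_lhs => rw [g.as_sum]
    rw [map_sum, map_sum, ← Finset.sum_sub_distrib]
    refine Finset.sum_congr rfl fun m _ => ?_
    simp_rw [mul_left_comm _ (C (C (g.coeff m)))]
    rw [← Finset.mul_sum, ← hb, ← mul_one (g.coeff m), ← C_mul_monomial]
    simp [mul_sub]
  · rw [map_sum]
    refine IsHomogeneous.sum _ _ _ fun m hm => ?_
    have hd : m.degree = d := by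
      rw [Finsupp.degree_eq_weight_one]
      exact hg (mem_support_iff.mp hm)
    simpa [hd] using (hb' m j).C_mul (g.coeff m)

/-- The coefficientwise extension of a linear functional on `MvPolynomial σ R`. -/
noncomputable def extendFunctional (l : MvPolynomial σ R →ₗ[R] R) :
    MvPolynomial σ (MvPolynomial σ R) →ₗ[MvPolynomial σ R] MvPolynomial σ R :=
  (basisMonomials σ (MvPolynomial σ R)).constr ℕ fun m => C (l (monomial m 1))

theorem extendFunctional_monomial (l : MvPolynomial σ R →ₗ[R] R) (m : σ →₀ ℕ)
    (r : MvPolynomial σ R) :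
    extendFunctional l (monomial m r) = r * C (l (monomial m 1)) := by
  have h : (monomial m r : MvPolynomial σ (MvPolynomial σ R)) = r • basisMonomials σ (MvPolynomial σ R) m := by
    simp [smul_monomial]
  rw [h, map_smul, extendFunctional, Module.Basis.constr_basis, smul_eq_mul]

theorem extendFunctional_map_C (l : MvPolynomial σ R →ₗ[R] R) (q : MvPolynomial σ R) :
    extendFunctional l (map C q) = C (l q) := by
  induction q using MvPolynomial.induction_on' with
  | monomial m a =>
    rw [map_monomial, extendFunctional_monomial, ← map_mul, ← smul_eq_mul, ← map_smul,
      smul_monomial, smul_eq_mul, mul_one]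
  | add p q hp hq => simp only [map_add, hp, hq]

theorem extendFunctional_map_C_mul_eq_zero (l : MvPolynomial σ R →ₗ[R] R)
    (q : MvPolynomial σ R) (hq : ∀ p, l (q * p) = 0) (P : MvPolynomial σ (MvPolynomial σ R)) :
    extendFunctional l (map C q * P) = 0 := by
  induction P using MvPolynomial.induction_on' with
  | monomial m r =>
    have h : map C q * monomial m r = C r * map C (q * monomial m 1) := by
      rw [map_mul, map_monomial, map_one, mul_left_comm, C_mul_monomial, mul_one]
    rw [h, ← smul_eq_C_mul, map_smul, extendFunctional_map_C, hq, map_zero, smul_zero]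
  | add p q hp hq => rw [mul_add, map_add, hp, hq, add_zero]

theorem constantCoeff_extendFunctional (l : MvPolynomial σ R →ₗ[R] R)
    (P : MvPolynomial σ (MvPolynomial σ R)) :
    constantCoeff (extendFunctional l P) = l (map constantCoeff P) := by
  induction P using MvPolynomial.induction_on' with
  | monomial m r =>
    rw [extendFunctional_monomial, map_mul, constantCoeff_C, map_monomial, ← smul_eq_mul,
      ← map_smul, smul_monomial, smul_eq_mul, mul_one]
  | add p q hp hq => simp only [map_add, hp, hq]

theorem homogeneousComponent_mem_span_range {ι : Type*} {g : ι → MvPolynomial σ R} {d : ι → ℕ}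
    (hg : ∀ i, (g i).IsHomogeneous (d i)) {p : MvPolynomial σ R}
    (hp : p ∈ Ideal.span (Set.range g)) (k : ℕ) :
    homogeneousComponent k p ∈ Ideal.span (Set.range g) := by
  let := gradedAlgebra (σ := σ) (R := R)
  have h := Ideal.homogeneous_span (homogeneousSubmodule σ R) (Set.range g) (by
    rintro _ ⟨i, rfl⟩
    exact ⟨d i, hg i⟩)
  have := h k hp
  rwa [← decomposition.decompose'_apply]

theorem homogeneousComponent_mul_self {h : MvPolynomial σ R} {k : ℕ}
    (hh : h.IsHomogeneous k) (u : MvPolynomial σ R) :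
    homogeneousComponent k (h * u) = constantCoeff u • h := by
  let := gradedAlgebra (σ := σ) (R := R)
  have := DirectSum.coe_decompose_mul_add_of_left_mem (homogeneousSubmodule σ R) (i := k) (j := 0)
    (b := u) hh
  erw [decomposition.decompose'_apply, decomposition.decompose'_apply] at this
  rw [add_zero, homogeneousComponent_zero] at this
  rw [this, smul_eq_C_mul, mul_comm, constantCoeff_eq]

theorem homogeneousComponent_mul_of_lt {h : MvPolynomial σ R} {j k : ℕ}
    (hh : h.IsHomogeneous k) (hj : j < k) (u : MvPolynomial σ R) :
    homogeneousComponent j (h * u) = 0 := by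
  let := gradedAlgebra (σ := σ) (R := R)
  rw [← decomposition.decompose'_apply]
  exact DirectSum.coe_decompose_mul_of_left_mem_of_not_le (homogeneousSubmodule σ R) hh hj.not_ge

theorem exists_X_pow_mem_of_zeroLocus {K : Type*} [Field K] [IsAlgClosed K] [Finite σ]
    (I : Ideal (MvPolynomial σ K)) (hI : ∀ z ∈ zeroLocus K I, z = 0) :
    ∃ N ≠ 0, ∀ i, (X i ^ N : MvPolynomial σ K) ∈ I := by
  have : Fintype σ := Fintype.ofFinite σ
  have h : ∀ i, (X i : MvPolynomial σ K) ∈ I.radical := fun i => by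
    rw [← vanishingIdeal_zeroLocus_eq_radical (K := K)]
    intro z hz
    simp [hI z hz]
  choose N hN using h
  refine ⟨∑ i, N i + 1, by omega, fun i => I.pow_mem_of_pow_mem (hN i) ?_⟩
  exact (Finset.single_le_sum (fun _ _ => Nat.zero_le _) (Finset.mem_univ i)).trans
    (Nat.le_succ _)

/-- **Macaulay's bound**: if forms `g i` of positive degree `e`, as many as there are variables,
have no common zero outside the origin, then all forms of degree exceeding
`card σ * (e - 1)` lie in the ideal they generate. -/
theorem mem_span_range_of_card_mul_lt {σ K : Type*} [Fintype σ] [Field K] [IsAlgClosed K]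
    {g : σ → MvPolynomial σ K} {e : ℕ} (he : e ≠ 0) (hg : ∀ i, (g i).IsHomogeneous e)
    (hz : ∀ z : σ → K, (∀ i, eval z (g i) = 0) → z = 0)
    {h : MvPolynomial σ K} {d : ℕ} (hh : h.IsHomogeneous d) (hd : Fintype.card σ * (e - 1) < d) :
    h ∈ Ideal.span (Set.range g) := by
  classical
  set I := Ideal.span (Set.range g) with hI
  obtain ⟨N, hN, hX⟩ := exists_X_pow_mem_of_zeroLocus I fun z hzI =>
    hz z fun i => hzI _ (Ideal.subset_span (Set.mem_range_self i))
  choose b hb hb' using fun i => exists_C_sub_map_C_eq_sum (hg i)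
  obtain ⟨q, hq, -⟩ := exists_C_sub_map_C_eq_sum hh
  let B : Matrix σ σ (MvPolynomial σ (MvPolynomial σ K)) := Matrix.of b
  let A : Matrix σ σ (MvPolynomial σ K) := (map constantCoeff).mapMatrix B
  have hAX : A.mulVec X = g := by
    refine _root_.funext fun i => ?_
    have h1 := congrArg (map (constantCoeff (R := K))) (hb i)
    have h0 : constantCoeff (g i) = 0 := by
      rw [constantCoeff_eq]
      exact (hg i).coeff_eq_zero (by simpa using he.symm)
    simp only [map_sub, map_C, h0, C_0, map_map, map_sum, map_mul, map_X, constantCoeff_X,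
      zero_sub, neg_mul, Finset.sum_neg_distrib, neg_inj] at h1
    rw [show (constantCoeff (R := K)).comp (C (σ := σ)) = RingHom.id K by ext; simp, map_id] at h1
    rw [h1]
    exact Finset.sum_congr rfl fun j _ => mul_comm _ _
  have hA : A.det ∉ I := det_notMem_span_of_X_pow_mem g A hAX hN hX
  have hAdeg : A.det.IsHomogeneous (Fintype.card σ * (e - 1)) := by
    rw [Matrix.det_apply]
    refine IsHomogeneous.sum _ _ _ fun τ _ => ?_
    rw [Units.smul_def, zsmul_eq_mul]
    have h1 : (∏ i, A (τ i) i).IsHomogeneous (∑ _i : σ, (e - 1)) :=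
      IsHomogeneous.prod _ _ _ fun i _ => hb' (τ i) i
    rw [Finset.sum_const, Finset.card_univ, smul_eq_mul] at h1
    simpa using h1.C_mul ((Equiv.Perm.sign τ : ℤ) : K)
  obtain ⟨l₀, hl₀, hl₀I⟩ := Submodule.exists_le_ker_of_notMem
    (p := I.restrictScalars K) (v := A.det) hA
  let l : MvPolynomial σ K →ₗ[K] K := l₀ ∘ₗ homogeneousComponent (Fintype.card σ * (e - 1))
  have hlA : l A.det ≠ 0 := by
    simpa only [l, LinearMap.comp_apply, homogeneousComponent_eq_self hAdeg] using hl₀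
  have hlI : ∀ i p, l (g i * p) = 0 := fun i p =>
    hl₀I (homogeneousComponent_mem_span_range hg
      (Ideal.mul_mem_right _ _ (Ideal.subset_span (Set.mem_range_self i))) _)
  have hlh : ∀ p, l (h * p) = 0 := fun p => by
    simp only [l, LinearMap.comp_apply, homogeneousComponent_mul_of_lt hh hd, map_zero]
  have key : h * extendFunctional l B.det ∈ I := by
    have h1 : B.det * (C h - map C h) ∈
        Ideal.span (Set.range fun i => (C (g i) - map C (g i) : MvPolynomial σ _)) := by
      rw [hq, Finset.mul_sum]
      refine Ideal.sum_mem _ fun j _ => ?_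
      rw [← mul_assoc]
      refine Ideal.mul_mem_right _ _ ?_
      have h2 := B.det_mul_mem_span_range_mulVec (fun j => C (X j) - X j) j
      rwa [show B.mulVec (fun j => C (X j) - X j) = fun i => C (g i) - map C (g i) by
        refine _root_.funext fun i => ?_
        rw [hb]
        exact Finset.sum_congr rfl fun j _ => mul_comm _ _] at h2
    obtain ⟨c, hc⟩ := Ideal.mem_span_range_iff_exists_fun.mp h1
    have h3 := congrArg (extendFunctional l) hc
    have h4 : ∀ (p : MvPolynomial σ K) P, extendFunctional l (P * (C p - map C p)) =
        p * extendFunctional l P - extendFunctional l (map C p * P) := by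
      intro p P
      rw [mul_sub, map_sub, mul_comm P, mul_comm P, ← smul_eq_C_mul, map_smul, smul_eq_mul]
    rw [map_sum, h4, extendFunctional_map_C_mul_eq_zero l h hlh, sub_zero] at h3
    rw [← h3]
    refine Ideal.sum_mem _ fun i _ => ?_
    rw [h4, extendFunctional_map_C_mul_eq_zero l _ (hlI i), sub_zero]
    exact Ideal.mul_mem_right _ _ (Ideal.subset_span (Set.mem_range_self i))
  have hcomp := homogeneousComponent_mem_span_range hg key d
  rw [homogeneousComponent_mul_self hh, constantCoeff_extendFunctional,
    show map constantCoeff B.det = A.det from RingHom.map_det _ _, smul_eq_C_mul] at hcomp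
  have := Ideal.mul_mem_left I (C (l A.det)⁻¹) hcomp
  rwa [← mul_assoc, ← C_mul, inv_mul_cancel₀ hlA, C_1, one_mul] at this

end MvPolynomial
end

/-- If `f ∈ ℂ[z₁,…,zₙ]` (n ≥ 2) is a non-degenerate homogeneous polynomial
of degree `n` (the origin is the only common zero of its partial derivatives), then every
homogeneous polynomial `φ` of degree at least `n(n−2)+1` lies in the Jacobian ideal of `f`. -/
theorem stmt_0 (n : ℕ) (hn : 2 ≤ n) (f : MvPolynomial (Fin n) ℂ)
    (hf : f.IsHomogeneous n)
    (hnd : ∀ z : Fin n → ℂ, (∀ i, eval z (pderiv i f) = 0) → z = 0)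
    (φ : MvPolynomial (Fin n) ℂ) (d : ℕ) (hφ : φ.IsHomogeneous d)
    (hd : n * (n - 2) + 1 ≤ d) :
    φ ∈ Ideal.span (Set.range fun i => pderiv i f) := by
  refine mem_span_range_of_card_mul_lt (e := n - 1) (by omega) (fun i => hf.pderiv) hnd hφ ?_
  rwa [Fintype.card_fin, Nat.sub_sub]
end

section
/- Let f ∈ ℂ[z₁,…,zₙ] be quasi-homogeneous with weights q₁,…,qₙ ∈ (0,1/2], and assume the origin is the only common zero in ℂⁿ of ∂f/∂z₁,…,∂f/∂zₙ. Then |df(z)|² := ∑_{ν=1}^{n} |∂f/∂z_ν(z)|² → ∞ as |z| → ∞. -/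
set_option autoImplicit false

open MvPolynomial Filter

/-- A partial derivative of a quasi-homogeneous polynomial is quasi-homogeneous of
weighted degree `1 - q i`. -/
theorem eval_pderiv_weighted_scaling {n : ℕ} {f : MvPolynomial (Fin n) ℂ} {q : Fin n → ℝ}
    (hquasi : ∀ α ∈ f.support, ∑ i, (α i : ℝ) * q i = 1) {l : ℝ} (hl : 0 < l)
    (w : Fin n → ℂ) (i : Fin n) :
    eval (fun j => ((l ^ q j : ℝ) : ℂ) * w j) (pderiv i f) =
      ((l ^ (1 - q i) : ℝ) : ℂ) * eval w (pderiv i f) := by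
  conv_lhs => rw [f.as_sum]
  conv_rhs => rw [f.as_sum]
  simp only [map_sum, pderiv_monomial, eval_monomial, Finset.mul_sum]
  refine Finset.sum_congr rfl fun α hα => ?_
  rcases Nat.eq_zero_or_pos (α i) with h0 | hpos
  · simp [h0]
  obtain ⟨β, rfl⟩ : ∃ β : Fin n →₀ ℕ, α = β + Finsupp.single i 1 :=
    ⟨α - Finsupp.single i 1, (tsub_add_cancel_of_le (Finsupp.single_le_iff.2 hpos)).symm⟩
  have hweight : ∑ j, q j * (β j : ℝ) = 1 - q i := by
    have h := hquasi _ hα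
    simp only [Finsupp.add_apply, Nat.cast_add, add_mul, Finset.sum_add_distrib,
      Finsupp.single_apply, Nat.cast_ite, Nat.cast_one, Nat.cast_zero, ite_mul, one_mul,
      zero_mul, Finset.sum_ite_eq, Finset.mem_univ, if_true] at h
    simp only [mul_comm (q _)]
    linarith
  have hprod : ∏ j, (l ^ q j) ^ β j = l ^ (1 - q i) := by
    rw [← hweight, Real.rpow_sum_of_pos hl]
    exact Finset.prod_congr rfl fun j _ => by rw [Real.rpow_mul hl.le, Real.rpow_natCast]
  rw [add_tsub_cancel_right, Finsupp.prod_fintype _ _ (by simp),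
    Finsupp.prod_fintype _ _ (by simp), ← hprod]
  simp only [mul_pow, Finset.prod_mul_distrib, Complex.ofReal_prod, Complex.ofReal_pow]
  ring

/-- Outside the unit ball of the sup norm, every vector is obtained from a unit vector by the
weighted action of some `l` that is at least the norm of the vector. -/
theorem exists_weighted_scaling_unit {n : ℕ} {q : Fin n → ℝ}
    (hq : ∀ i, 0 < q i ∧ q i ≤ 1 / 2) {z : Fin n → ℂ} (hz : 1 ≤ ‖z‖) :
    ∃ (l : ℝ) (w : Fin n → ℂ), ‖z‖ ≤ l ∧ ‖w‖ = 1 ∧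
      z = fun j => ((l ^ q j : ℝ) : ℂ) * w j := by
  have hne : Nonempty (Fin n) := by
    by_contra h
    rw [not_nonempty_iff] at h
    rw [Subsingleton.elim z 0, norm_zero] at hz
    linarith
  obtain ⟨i, -, hi⟩ := Finset.exists_max_image Finset.univ
    (fun j => ‖z j‖ ^ (q j)⁻¹) Finset.univ_nonempty
  set l := ‖z i‖ ^ (q i)⁻¹ with hl
  obtain ⟨k, hk⟩ : ∃ k, ‖z‖ ≤ ‖z k‖ := by
    obtain ⟨k, -, hk⟩ := Finset.exists_max_image Finset.univ
      (fun j => ‖z j‖) Finset.univ_nonempty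
    exact ⟨k, (pi_norm_le_iff_of_nonneg (norm_nonneg _)).2 fun j => hk j (Finset.mem_univ j)⟩
  have hzl : ‖z‖ ≤ l := by
    refine hk.trans (le_trans ?_ (hi k (Finset.mem_univ k)))
    refine Real.self_le_rpow_of_one_le (hz.trans hk) ?_
    exact (one_le_inv₀ (hq k).1).2 ((hq k).2.trans (by norm_num))
  have hl0 : 0 < l := by linarith
  have hnorm : ∀ j, ‖((l ^ q j : ℝ) : ℂ)⁻¹ * z j‖ = (l ^ q j)⁻¹ * ‖z j‖ := fun j => by
    rw [norm_mul, norm_inv, Complex.norm_real, Real.norm_of_nonneg (by positivity)]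
  refine ⟨l, fun j => ((l ^ q j : ℝ) : ℂ)⁻¹ * z j, hzl, le_antisymm ?_ ?_, ?_⟩
  · refine (pi_norm_le_iff_of_nonneg zero_le_one).2 fun j => ?_
    rw [hnorm, inv_mul_le_iff₀ (by positivity), mul_one]
    calc ‖z j‖ = (‖z j‖ ^ (q j)⁻¹) ^ q j :=
          (Real.rpow_inv_rpow (norm_nonneg _) (hq j).1.ne').symm
      _ ≤ l ^ q j := Real.rpow_le_rpow (by positivity) (hi j (Finset.mem_univ j)) (hq j).1.le
  · refine le_trans (le_of_eq ?_) (norm_le_pi_norm _ i)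
    have hli : l ^ q i = ‖z i‖ := Real.rpow_inv_rpow (norm_nonneg _) (hq i).1.ne'
    rw [hnorm, ← hli, inv_mul_cancel₀ (by positivity)]
  · ext j
    have : ((l ^ q j : ℝ) : ℂ) ≠ 0 := Complex.ofReal_ne_zero.2 (by positivity)
    rw [mul_inv_cancel_left₀ this]

/-- The squared gradient norm is bounded below by a positive constant on the unit sphere. -/
theorem exists_pos_le_sum_norm_pderiv_sq {n : ℕ} {f : MvPolynomial (Fin n) ℂ}
    (hnd : ∀ z : Fin n → ℂ, (∀ i, eval z (pderiv i f) = 0) → z = 0) :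
    ∃ c : ℝ, 0 < c ∧ ∀ w : Fin n → ℂ, ‖w‖ = 1 → c ≤ ∑ ν, ‖eval w (pderiv ν f)‖ ^ 2 := by
  have hcont : Continuous fun w : Fin n → ℂ => ∑ ν, ‖eval w (pderiv ν f)‖ ^ 2 :=
    continuous_finsetSum _ fun ν _ => ((MvPolynomial.continuous_eval _).norm.pow 2)
  obtain ⟨c, hc, h⟩ := (isCompact_sphere (0 : Fin n → ℂ) 1).exists_forall_le'
    hcont.continuousOn (a := 0) fun w hw => by
      refine lt_of_le_of_ne (by positivity) fun h0 => ?_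
      have hw0 : w = 0 := hnd w fun ν => by
        have := (Finset.sum_eq_zero_iff_of_nonneg fun ν _ => by positivity).1 h0.symm ν
          (Finset.mem_univ ν)
        simpa using this
      simp [hw0] at hw
  exact ⟨c, hc, fun w hw => h w (by simpa using hw)⟩

/-- If `f ∈ ℂ[z₁,…,zₙ]` is quasi-homogeneous with weights
`q₁,…,qₙ ∈ (0,1/2]` and the origin is the only common zero of its partial derivatives,
then `|df(z)|² = ∑_ν |∂f/∂z_ν(z)|² → ∞` as `|z| → ∞`. -/
theorem stmt_3 (n : ℕ) (f : MvPolynomial (Fin n) ℂ) (q : Fin n → ℝ)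
    (hq : ∀ i, 0 < q i ∧ q i ≤ 1 / 2)
    (hquasi : ∀ α ∈ f.support, ∑ i, (α i : ℝ) * q i = 1)
    (hnd : ∀ z : Fin n → ℂ, (∀ i, eval z (pderiv i f) = 0) → z = 0) :
    Tendsto (fun z : EuclideanSpace ℂ (Fin n) =>
        ∑ ν, ‖eval (fun i => z i) (pderiv ν f)‖ ^ 2)
      (Bornology.cobounded (EuclideanSpace ℂ (Fin n))) atTop := by
  obtain ⟨c, hc, hcw⟩ := exists_pos_le_sum_norm_pderiv_sq hnd
  have hofLp : Tendsto (fun z : EuclideanSpace ℂ (Fin n) => z.ofLp)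
      (Bornology.cobounded _) (Bornology.cobounded (Fin n → ℂ)) :=
    (PiLp.antilipschitzWith_ofLp 2 fun _ : Fin n => ℂ).tendsto_cobounded
  suffices h : Tendsto (fun z : Fin n → ℂ => ∑ ν, ‖eval z (pderiv ν f)‖ ^ 2)
      (Bornology.cobounded (Fin n → ℂ)) atTop from h.comp hofLp
  have hnorm : Tendsto (fun z : Fin n → ℂ => ‖z‖) (Bornology.cobounded (Fin n → ℂ)) atTop :=
    tendsto_norm_cobounded_atTop
  refine tendsto_atTop_mono' _ ?_ (hnorm.const_mul_atTop hc)
  filter_upwards [hnorm.eventually_ge_atTop 1] with z hz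
  obtain ⟨l, w, hzl, hw, hzw⟩ := exists_weighted_scaling_unit hq hz
  have hl : 1 ≤ l := hz.trans hzl
  have hl0 : 0 < l := by linarith
  calc c * ‖z‖ ≤ l * c := by rw [mul_comm]; gcongr
    _ ≤ l * ∑ ν, ‖eval w (pderiv ν f)‖ ^ 2 := by gcongr; exact hcw w hw
    _ = ∑ ν, l * ‖eval w (pderiv ν f)‖ ^ 2 := Finset.mul_sum _ _ _
    _ ≤ ∑ ν, ‖eval z (pderiv ν f)‖ ^ 2 := Finset.sum_le_sum fun ν _ => ?_
  rw [hzw, eval_pderiv_weighted_scaling hquasi hl0, norm_mul, mul_pow, Complex.norm_real,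
    Real.norm_of_nonneg (by positivity)]
  gcongr
  rw [← Real.rpow_mul_natCast hl0.le]
  refine Real.self_le_rpow_of_one_le hl ?_
  push_cast
  linarith [(hq ν).2]
end

section
/- Let f ∈ ℂ[z₁,…,zₙ] be quasi-homogeneous with weights q₁,…,qₙ ∈ (0,1/2], and assume the origin is the only common zero in ℂⁿ of ∂f/∂z₁,…,∂f/∂zₙ. Then for every ε > 0 there is a constant C > 0 such that |∂²f/∂z_{ν₁}∂z_{ν₂}(z)| ≤ ε |df(z)|² + C for all z ∈ ℂⁿ and all ν₁, ν₂ ∈ {1,…,n}. -/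
set_option autoImplicit false

open MvPolynomial

/-- A polynomial all of whose monomials have weighted degree `d` scales with exponent `d`. -/
lemma eval_rpow_smul_of_weightedDegree {σ : Type*} [Fintype σ] (p : MvPolynomial σ ℂ)
    (q : σ → ℝ) (d : ℝ) (hp : ∀ α ∈ p.support, ∑ i, (α i : ℝ) * q i = d)
    {t : ℝ} (ht : 0 < t) (w : σ → ℂ) :
    eval (fun i => ((t ^ q i : ℝ) : ℂ) * w i) p = ((t ^ d : ℝ) : ℂ) * eval w p := by
  rw [eval_eq', eval_eq', Finset.mul_sum]
  refine Finset.sum_congr rfl fun α hα => ?_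
  have h : ∏ i, (((t ^ q i : ℝ) : ℂ)) ^ α i = ((t ^ d : ℝ) : ℂ) := by
    rw [← hp α hα, Real.rpow_sum_of_pos ht]
    push_cast
    refine Finset.prod_congr rfl fun i _ => ?_
    rw [mul_comm, Real.rpow_mul_natCast ht.le]
    push_cast
    rfl
  simp only [mul_pow, Finset.prod_mul_distrib, h]
  ring

/-- Differentiating in `z_ν` lowers the weighted degree by `q ν`. -/
lemma weightedDegree_pderiv {σ : Type*} [Fintype σ] (p : MvPolynomial σ ℂ)
    (q : σ → ℝ) (d : ℝ) (hp : ∀ α ∈ p.support, ∑ i, (α i : ℝ) * q i = d) (ν : σ) :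
    ∀ α ∈ (pderiv ν p).support, ∑ i, (α i : ℝ) * q i = d - q ν := by
  classical
  intro α hα
  have h : α + Finsupp.single ν 1 ∈ p.support := by
    rw [mem_support_iff] at hα ⊢
    intro h0
    exact hα (by rw [coeff_pderiv, h0]; simp)
  rw [← hp _ h]
  simp [add_mul, Finset.sum_add_distrib, Finsupp.single_apply]

/-- Every vector outside the open unit ball is a weighted dilate, by a factor `t ≥ 1`,
of a unit vector for the sup norm. -/
lemma exists_weighted_dilation {σ : Type*} [Fintype σ] (q : σ → ℝ) (hq : ∀ i, 0 < q i)
    (z : σ → ℂ) (hz : 1 ≤ ‖z‖) :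
    ∃ t : ℝ, 1 ≤ t ∧ ∃ w : σ → ℂ, ‖w‖ = 1 ∧ z = fun i => ((t ^ q i : ℝ) : ℂ) * w i := by
  have : Nonempty σ := by
    by_contra h
    rw [not_nonempty_iff] at h
    rw [Subsingleton.elim z 0, norm_zero] at hz
    linarith
  obtain ⟨i₀, hi₀⟩ := Finite.exists_max fun i => ‖z i‖ ^ (q i)⁻¹
  set t := ‖z i₀‖ ^ (q i₀)⁻¹ with ht
  have ht₀ : 0 ≤ t := by positivity
  have hle : ∀ i, ‖z i‖ ≤ t ^ q i := fun i => by
    rw [← Real.rpow_inv_le_iff_of_pos (norm_nonneg _) ht₀ (hq i)]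
    exact hi₀ i
  have heq : ‖z i₀‖ = t ^ q i₀ := (Real.rpow_inv_rpow (norm_nonneg _) (hq i₀).ne').symm
  have ht₁ : 1 ≤ t := by
    by_contra! h
    refine absurd hz (not_le.2 ((pi_norm_lt_iff one_pos).2 fun i => ?_))
    exact (hle i).trans_lt (Real.rpow_lt_one ht₀ h (hq i))
  have hpos : ∀ i, 0 < t ^ q i := fun i => Real.rpow_pos_of_pos (by linarith) _
  have hw : ∀ i, ‖z i / ((t ^ q i : ℝ) : ℂ)‖ = ‖z i‖ / t ^ q i := fun i => by
    rw [norm_div, Complex.norm_of_nonneg (hpos i).le]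
  refine ⟨t, ht₁, fun i => z i / ((t ^ q i : ℝ) : ℂ), le_antisymm ?_ ?_, ?_⟩
  · refine (pi_norm_le_iff_of_nonneg zero_le_one).2 fun i => ?_
    rw [hw, div_le_one (hpos i)]
    exact hle i
  · refine le_trans ?_ (norm_le_pi_norm _ i₀)
    rw [hw, heq, div_self (hpos i₀).ne']
  · funext i
    exact (mul_div_cancel₀ _ (Complex.ofReal_ne_zero.2 (hpos i).ne')).symm

/-- A sublinear power is bounded by any positive multiple of the identity up to a constant. -/
lemma exists_mul_rpow_le_mul_add {s : ℝ} (hs₀ : 0 ≤ s) (hs₁ : s < 1) {M : ℝ} (hM : 0 ≤ M)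
    {a : ℝ} (ha : 0 < a) :
    ∃ C, 0 ≤ C ∧ ∀ t : ℝ, 1 ≤ t → M * t ^ s ≤ a * t + C := by
  obtain ⟨L, hL⟩ := Filter.eventually_atTop.1
    ((tendsto_rpow_atTop (sub_pos.2 hs₁)).eventually_ge_atTop (M / a))
  refine ⟨M * |L| ^ s, by positivity, fun t ht => ?_⟩
  have ht₀ : 0 ≤ t := by linarith
  have hC : 0 ≤ M * |L| ^ s := by positivity
  rcases le_total L t with h | h
  · have hMt : M ≤ a * t ^ (1 - s) := (div_le_iff₀' ha).1 (hL t h)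
    have hsplit : t ^ (1 - s) * t ^ s = t := by
      rw [← Real.rpow_add (by linarith), sub_add_cancel, Real.rpow_one]
    have := mul_le_mul_of_nonneg_right hMt (Real.rpow_nonneg ht₀ s)
    rw [mul_assoc, hsplit] at this
    linarith
  · have : M * t ^ s ≤ M * |L| ^ s := by
      gcongr
      exact h.trans (le_abs_self L)
    have : 0 ≤ a * t := by positivity
    linarith

/-- If `f ∈ ℂ[z₁,…,zₙ]` is quasi-homogeneous with weights
`q₁,…,qₙ ∈ (0,1/2]` and the origin is the only common zero of its partial derivatives,
then for every `ε > 0` there is `C > 0` such that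
`|∂²f/∂z_{ν₁}∂z_{ν₂}(z)| ≤ ε |df(z)|² + C` for all `z` and all `ν₁, ν₂`. -/
theorem stmt_4 (n : ℕ) (f : MvPolynomial (Fin n) ℂ) (q : Fin n → ℝ)
    (hq : ∀ i, 0 < q i ∧ q i ≤ 1 / 2)
    (hquasi : ∀ α ∈ f.support, ∑ i, (α i : ℝ) * q i = 1)
    (hnd : ∀ z : Fin n → ℂ, (∀ i, eval z (pderiv i f) = 0) → z = 0) :
    ∀ ε > (0 : ℝ), ∃ C > (0 : ℝ), ∀ (z : Fin n → ℂ) (ν₁ ν₂ : Fin n),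
      ‖eval z (pderiv ν₁ (pderiv ν₂ f))‖ ≤
        ε * (∑ ν, ‖eval z (pderiv ν f)‖ ^ 2) + C := by
  intro ε hε
  have hcont : ∀ p : MvPolynomial (Fin n) ℂ, Continuous fun z => eval z p :=
    fun p => MvPolynomial.continuous_eval p
  obtain ⟨m, hm, hmle⟩ : ∃ m : ℝ, 0 < m ∧ ∀ w ∈ Metric.sphere (0 : Fin n → ℂ) 1,
      m ≤ ∑ ν, ‖eval w (pderiv ν f)‖ ^ 2 := by
    refine (isCompact_sphere _ _).exists_forall_le'
      (continuous_finsetSum _ fun ν _ => (hcont _).norm.pow 2).continuousOn fun w hw => ?_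
    by_contra! h
    have h0 := (Finset.sum_eq_zero_iff_of_nonneg fun ν _ => sq_nonneg _).1
      (le_antisymm h (Finset.sum_nonneg fun ν _ => sq_nonneg _))
    have : w = 0 := hnd w fun i => by simpa using h0 i (Finset.mem_univ i)
    simp [this] at hw
  have hdf : ∀ t : ℝ, 1 ≤ t → ∀ w : Fin n → ℂ, ‖w‖ = 1 →
      t * m ≤ ∑ ν, ‖eval (fun i => ((t ^ q i : ℝ) : ℂ) * w i) (pderiv ν f)‖ ^ 2 := by
    intro t ht w hw
    have ht₀ : 0 < t := by linarith
    refine (mul_le_mul_of_nonneg_left (hmle w (by simpa using hw)) ht₀.le).trans ?_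
    rw [Finset.mul_sum]
    refine Finset.sum_le_sum fun ν _ => ?_
    rw [eval_rpow_smul_of_weightedDegree _ q _ (weightedDegree_pderiv f q 1 hquasi ν) ht₀,
      norm_mul, mul_pow, Complex.norm_of_nonneg (by positivity)]
    gcongr
    rw [← Real.rpow_mul_natCast ht₀.le]
    exact Real.self_le_rpow_of_one_le ht (by push_cast; linarith [(hq ν).2])
  have key : ∀ ν₁ ν₂ : Fin n, ∃ C : ℝ, 0 ≤ C ∧ ∀ z : Fin n → ℂ,
      ‖eval z (pderiv ν₁ (pderiv ν₂ f))‖ ≤ ε * (∑ ν, ‖eval z (pderiv ν f)‖ ^ 2) + C := by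
    intro ν₁ ν₂
    obtain ⟨M, hM⟩ := (isCompact_closedBall (0 : Fin n → ℂ) 1).exists_bound_of_continuousOn
      (hcont (pderiv ν₁ (pderiv ν₂ f))).continuousOn
    have hM₀ : 0 ≤ M := (norm_nonneg _).trans (hM 0 (by simp))
    obtain ⟨C, hC, hCle⟩ := exists_mul_rpow_le_mul_add (s := 1 - q ν₂ - q ν₁)
      (by linarith [(hq ν₁).2, (hq ν₂).2]) (by linarith [(hq ν₁).1, (hq ν₂).1]) hM₀
      (mul_pos hε hm)
    refine ⟨C + M, by positivity, fun z => ?_⟩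
    rcases le_total ‖z‖ 1 with hz | hz
    · have := hM z (by simpa using hz)
      have : 0 ≤ ε * ∑ ν, ‖eval z (pderiv ν f)‖ ^ 2 := by positivity
      linarith
    · obtain ⟨t, ht, w, hw, rfl⟩ := exists_weighted_dilation q (fun i => (hq i).1) z hz
      have ht₀ : 0 < t := by linarith
      have hMw := hM w (by simp [hw])
      have hlower := mul_le_mul_of_nonneg_left (hdf t ht w hw) hε.le
      have hupper := hCle t ht
      rw [eval_rpow_smul_of_weightedDegree _ q _ (weightedDegree_pderiv _ q _
        (weightedDegree_pderiv f q 1 hquasi ν₂) ν₁) ht₀, norm_mul,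
        Complex.norm_of_nonneg (by positivity)]
      have := mul_le_mul_of_nonneg_left hMw (Real.rpow_nonneg ht₀.le (1 - q ν₂ - q ν₁))
      linarith
  choose C hC hCle using key
  refine ⟨(∑ ν₁, ∑ ν₂, C ν₁ ν₂) + 1, ?_, fun z ν₁ ν₂ => (hCle ν₁ ν₂ z).trans ?_⟩
  · exact add_pos_of_nonneg_of_pos
      (Finset.sum_nonneg fun ν₁ _ => Finset.sum_nonneg fun ν₂ _ => hC ν₁ ν₂) one_pos
  · have h₁ := Finset.single_le_sum (fun ν _ => hC ν₁ ν) (Finset.mem_univ ν₂)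
    have h₂ := Finset.single_le_sum (f := fun ν => ∑ ν', C ν ν')
      (fun ν _ => Finset.sum_nonneg fun ν' _ => hC ν ν') (Finset.mem_univ ν₁)
    linarith
end

section
/- Let f ∈ ℂ[z₁,…,zₙ] (n ≥ 2) be a non-degenerate homogeneous polynomial of degree n. Fix ε₁ > 0 and let U := {z ∈ ℂⁿ∖{0} : |Re f(z/‖z‖)| ≥ ε₁} be the corresponding cone. Then there exists a constant c = c(n,f,ε₁) > 0 such that for every sufficiently small ε > 0 there exists a function 𝑓̃ : ℂⁿ → ℝ, continuous on ℂⁿ and smooth on ℂⁿ∖{0}, satisfying: (i) 𝑓̃(z) ≥ |Re f(z)| for all z ∈ ℂⁿ, and 𝑓̃(z) = |Re f(z)| for all z ∈ U; (ii) ‖∇𝑓̃(z)‖ ≤ (1 + c·ε)·‖∇Re f(z)‖ for all z ∈ ℂⁿ∖{0}, where ∇ is the real gradient on ℝ^{2n}; (iii) 𝑓̃(z) ≥ (ε/2)·‖z‖ⁿ for all z ∈ ℂⁿ. -/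
set_option autoImplicit false

open MvPolynomial

noncomputable section

open Filter Topology

theorem MvPolynomial.IsHomogeneous.eval_const_mul {σ R : Type*} [Fintype σ] [CommSemiring R]
    {f : MvPolynomial σ R} {n : ℕ} (hf : f.IsHomogeneous n) (c : R) (z : σ → R) :
    eval (fun i => c * z i) f = c ^ n * eval z f := by
  rw [eval_eq', eval_eq', Finset.mul_sum]
  refine Finset.sum_congr rfl fun d hd => ?_
  have hdeg : ∑ i, d i = n := by
    rw [← hf (mem_support_iff.mp hd), Finsupp.weight_apply, Finsupp.sum_fintype _ _ (by simp)]
    simp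
  simp only [mul_pow, Finset.prod_mul_distrib, Finset.prod_pow_eq_pow_sum, hdeg]
  ring

theorem MvPolynomial.hasFDerivAt_eval_euclideanSpace {σ : Type*} [Fintype σ]
    (f : MvPolynomial σ ℂ) (z : EuclideanSpace ℂ σ) :
    HasFDerivAt (fun w : EuclideanSpace ℂ σ => eval (fun i => w i) f)
      (∑ i, eval (fun j => z j) (pderiv i f) • EuclideanSpace.proj (𝕜 := ℂ) i) z := by
  classical
  induction f using MvPolynomial.induction_on with
  | C a =>
    simp only [eval_C]
    refine (hasFDerivAt_const a z).congr_fderiv ?_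
    ext v
    simp
  | add p q hp hq =>
    simp only [map_add]
    refine (hp.add hq).congr_fderiv ?_
    ext v
    simp [add_mul, Finset.sum_add_distrib]
  | mul_X p k hp =>
    have hk : HasFDerivAt (fun w : EuclideanSpace ℂ σ => w k)
        (EuclideanSpace.proj (𝕜 := ℂ) k) z :=
      (EuclideanSpace.proj (𝕜 := ℂ) k).hasFDerivAt
    simp only [map_mul, eval_X]
    refine (hp.mul hk).congr_fderiv ?_
    ext v
    simp [Derivation.leibniz, pderiv_X, Pi.single_apply, apply_ite, add_mul, ite_mul,
      Finset.sum_add_distrib, Finset.mul_sum, mul_assoc]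

theorem norm_fderiv_smul_mul_of_homogeneous {E : Type*} [NormedAddCommGroup E] [NormedSpace ℝ E]
    {F : E → ℝ} {k : ℕ} {c : ℝ} (hc : 0 < c) (hF : ∀ z, F (c • z) = c ^ k * F z) (z : E) :
    ‖fderiv ℝ F (c • z)‖ * c = c ^ k * ‖fderiv ℝ F z‖ := by
  have h1 : fderiv ℝ (fun w => F (c • w)) z = c • fderiv ℝ F (c • z) := fderiv_comp_smul c
  have h2 : fderiv ℝ (fun w => F (c • w)) z = c ^ k • fderiv ℝ F z := by
    rw [funext hF]
    exact congrFun (fderiv_const_smul_field (c ^ k)) z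
  have h3 := congrArg norm (h1.symm.trans h2)
  rw [norm_smul, norm_smul, Real.norm_of_nonneg hc.le, Real.norm_of_nonneg (by positivity)] at h3
  linarith

theorem norm_fderiv_mul_norm_of_homogeneous {E : Type*} [NormedAddCommGroup E] [NormedSpace ℝ E]
    {F : E → ℝ} {k : ℕ} (hF : ∀ c : ℝ, 0 < c → ∀ z, F (c • z) = c ^ k * F z) {z : E}
    (hz : z ≠ 0) :
    ‖fderiv ℝ F z‖ * ‖z‖ = ‖z‖ ^ k * ‖fderiv ℝ F (‖z‖⁻¹ • z)‖ := by
  have hr : 0 < ‖z‖ := norm_pos_iff.mpr hz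
  have h := norm_fderiv_smul_mul_of_homogeneous hr (hF _ hr) (‖z‖⁻¹ • z)
  rwa [smul_inv_smul₀ hr.ne'] at h

theorem exists_norm_fderiv_le_of_homogeneous {E : Type*} [NormedAddCommGroup E] [NormedSpace ℝ E]
    [FiniteDimensional ℝ E] {F : E → ℝ} {k : ℕ} (hs : ContDiffOn ℝ 1 F {0}ᶜ)
    (hF : ∀ c : ℝ, 0 < c → ∀ z, F (c • z) = c ^ k * F z) :
    ∃ C > 0, ∀ z, z ≠ 0 → ‖fderiv ℝ F z‖ * ‖z‖ ≤ C * ‖z‖ ^ k := by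
  have hc : ContinuousOn (fderiv ℝ F) (Metric.sphere 0 1) :=
    (hs.continuousOn_fderiv_of_isOpen isOpen_compl_singleton le_rfl).mono
      fun z hz h => by simp_all
  obtain ⟨C, hC⟩ := (isCompact_sphere (0 : E) 1).exists_bound_of_continuousOn hc
  refine ⟨max C 1, by positivity, fun z hz => ?_⟩
  rw [norm_fderiv_mul_norm_of_homogeneous hF hz, mul_comm]
  gcongr
  exact (hC _ (by simp [norm_smul, hz])).trans (le_max_left _ _)

theorem exists_le_norm_fderiv_of_homogeneous {E : Type*} [NormedAddCommGroup E] [NormedSpace ℝ E]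
    [FiniteDimensional ℝ E] {F : E → ℝ} {k : ℕ} (hs : ContDiffOn ℝ 1 F {0}ᶜ)
    (hF : ∀ c : ℝ, 0 < c → ∀ z, F (c • z) = c ^ k * F z)
    (hd : ∀ z, z ≠ 0 → fderiv ℝ F z ≠ 0) :
    ∃ m > 0, ∀ z, z ≠ 0 → m * ‖z‖ ^ k ≤ ‖fderiv ℝ F z‖ * ‖z‖ := by
  have hc : ContinuousOn (fderiv ℝ F) (Metric.sphere 0 1) :=
    (hs.continuousOn_fderiv_of_isOpen isOpen_compl_singleton le_rfl).mono
      fun z hz h => by simp_all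
  obtain ⟨m, hm, hmb⟩ := (isCompact_sphere (0 : E) 1).exists_forall_le' hc.norm (a := 0)
    fun z hz => norm_pos_iff.mpr (hd z fun h => by simp_all)
  refine ⟨m, hm, fun z hz => ?_⟩
  rw [norm_fderiv_mul_norm_of_homogeneous hF hz, mul_comm]
  gcongr
  exact hmb _ (by simp [norm_smul, hz])

/-- The function `‖z‖ ^ (2n) χ(h(z) / ‖z‖ ^ n)`, where `χ` is a smooth cutoff equal to `1` on
`|t| ≤ δ / √2` and to `0` on `|t| ≥ δ`. -/
def conicCutoff {E : Type*} [NormedAddCommGroup E] (h : E → ℝ) (n : ℕ) (δ : ℝ) (z : E) : ℝ :=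
  (‖z‖ ^ 2) ^ n * Real.smoothTransition (2 - 2 * h z ^ 2 / (δ ^ 2 * (‖z‖ ^ 2) ^ n))

section conicCutoff

variable {E : Type*} [NormedAddCommGroup E] {h : E → ℝ} {n : ℕ} {δ : ℝ}

theorem conicCutoff_nonneg (z : E) : 0 ≤ conicCutoff h n δ z :=
  mul_nonneg (by positivity) (Real.smoothTransition.nonneg _)

theorem conicCutoff_le (z : E) : conicCutoff h n δ z ≤ (‖z‖ ^ 2) ^ n :=
  mul_le_of_le_one_right (by positivity) (Real.smoothTransition.le_one _)

theorem conicCutoff_smul [NormedSpace ℝ E] (hh : ∀ c : ℝ, 0 < c → ∀ z, h (c • z) = c ^ n * h z) (c : ℝ)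
    (hc : 0 < c) (z : E) : conicCutoff h n δ (c • z) = c ^ (2 * n) * conicCutoff h n δ z := by
  have hquot : 2 * (c ^ n * h z) ^ 2 / (δ ^ 2 * ((c * ‖z‖) ^ 2) ^ n)
      = 2 * h z ^ 2 / (δ ^ 2 * (‖z‖ ^ 2) ^ n) := by
    rw [← mul_div_mul_left (2 * h z ^ 2) _ (pow_ne_zero (2 * n) hc.ne')]
    congr 1 <;> ring
  rw [conicCutoff, conicCutoff, hh c hc, norm_smul, Real.norm_of_nonneg hc.le, hquot]
  ring

theorem contDiffOn_conicCutoff [InnerProductSpace ℝ E] (hs : ContDiff ℝ (⊤ : ℕ∞) h) (hδ : δ ≠ 0) :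
    ContDiffOn ℝ (⊤ : ℕ∞) (conicCutoff h n δ) {0}ᶜ := by
  have hr : ContDiff ℝ (⊤ : ℕ∞) fun z : E => (‖z‖ ^ 2) ^ n := (contDiff_norm_sq ℝ).pow n
  refine hr.contDiffOn.mul (Real.smoothTransition.contDiff.comp_contDiffOn ?_)
  refine contDiffOn_const.sub (ContDiffOn.div (contDiff_const.mul (hs.pow 2)).contDiffOn
    (contDiff_const.mul hr).contDiffOn fun z hz => ?_)
  have : z ≠ 0 := hz
  positivity

theorem conicCutoff_eq_zero (hδ : 0 < δ) {z : E} (hz : z ≠ 0) (hle : δ * ‖z‖ ^ n ≤ |h z|) :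
    conicCutoff h n δ z = 0 := by
  rw [conicCutoff, Real.smoothTransition.zero_of_nonpos, mul_zero]
  have hsq := pow_le_pow_left₀ (by positivity) hle 2
  rw [sq_abs] at hsq
  rw [sub_nonpos, le_div_iff₀ (by positivity)]
  calc _ = 2 * (δ * ‖z‖ ^ n) ^ 2 := by ring
    _ ≤ _ := by gcongr

theorem sq_le_sq_add_conicCutoff {ε : ℝ} (hε : 0 < ε) (hεδ : ε ≤ δ) {z : E} (hz : z ≠ 0) :
    (ε / 2 * ‖z‖ ^ n) ^ 2 ≤ h z ^ 2 + ε ^ 2 * conicCutoff h n δ z := by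
  have hδ : 0 < δ := hε.trans_le hεδ
  have hR : (‖z‖ ^ 2) ^ n = (‖z‖ ^ n) ^ 2 := by ring
  by_cases hle : 2 * h z ^ 2 ≤ δ ^ 2 * (‖z‖ ^ 2) ^ n
  · rw [conicCutoff, Real.smoothTransition.one_of_one_le, hR]
    · nlinarith [sq_nonneg (h z), sq_nonneg (ε * ‖z‖ ^ n)]
    · have : 2 * h z ^ 2 / (δ ^ 2 * (‖z‖ ^ 2) ^ n) ≤ 1 := (div_le_one (by positivity)).mpr hle
      linarith
  · have h1 : ε ^ 2 * (‖z‖ ^ 2) ^ n ≤ δ ^ 2 * (‖z‖ ^ 2) ^ n := by gcongr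
    have h2 : 0 ≤ ε ^ 2 * conicCutoff h n δ z := mul_nonneg (by positivity) (conicCutoff_nonneg z)
    have h3 : 0 ≤ ε ^ 2 * (‖z‖ ^ 2) ^ n := by positivity
    have h4 : (ε / 2 * ‖z‖ ^ n) ^ 2 = ε ^ 2 * (‖z‖ ^ 2) ^ n / 4 := by ring
    linarith

end conicCutoff

theorem norm_fderiv_sqrt_sq_add_le {E : Type*} [NormedAddCommGroup E] [NormedSpace ℝ E]
    {h g : E → ℝ} {z : E} {a : ℝ} (ha : 0 ≤ a) (hh : DifferentiableAt ℝ h z)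
    (hg : DifferentiableAt ℝ g z) (hg0 : 0 ≤ g z) (hpos : 0 < h z ^ 2 + a * g z) :
    ‖fderiv ℝ (fun w => √(h w ^ 2 + a * g w)) z‖ ≤
      ‖fderiv ℝ h z‖ + a / (2 * √(h z ^ 2 + a * g z)) * ‖fderiv ℝ g z‖ := by
  set S := √(h z ^ 2 + a * g z) with hS
  have hS0 : 0 < S := Real.sqrt_pos.mpr hpos
  have hhS : |h z| ≤ S := Real.abs_le_sqrt (by nlinarith [mul_nonneg ha hg0])
  have hd := ((hh.hasFDerivAt.pow 2).add (hg.hasFDerivAt.const_mul a)).sqrt hpos.ne'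
  have hd' : fderiv ℝ (fun w => √(h w ^ 2 + a * g w)) z
      = (h z / S) • fderiv ℝ h z + (a / (2 * S)) • fderiv ℝ g z := by
    refine hd.fderiv.trans ?_
    ext v
    simp [← hS]
    field_simp
  rw [hd']
  refine (norm_add_le _ _).trans ?_
  rw [norm_smul, norm_smul, Real.norm_eq_abs, Real.norm_of_nonneg (by positivity : 0 ≤ a / (2 * S)),
    abs_div, abs_of_pos hS0]
  gcongr
  exact mul_le_of_le_one_left (norm_nonneg _) ((div_le_one hS0).mpr hhS)

theorem exists_smoothing_abs_of_homogeneous {E : Type*} [NormedAddCommGroup E]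
    [InnerProductSpace ℝ E] [FiniteDimensional ℝ E] {h : E → ℝ} {n : ℕ} (hn : n ≠ 0)
    (hs : ContDiff ℝ (⊤ : ℕ∞) h) (hh : ∀ c : ℝ, ∀ z, h (c • z) = c ^ n * h z)
    (hd : ∀ z, z ≠ 0 → fderiv ℝ h z ≠ 0) {δ : ℝ} (hδ : 0 < δ) :
    ∃ c > 0, ∀ ε, 0 < ε → ε < δ → ∃ F : E → ℝ,
      Continuous F ∧ ContDiffOn ℝ (⊤ : ℕ∞) F {0}ᶜ ∧ (∀ z, |h z| ≤ F z) ∧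
      (∀ z, z ≠ 0 → δ * ‖z‖ ^ n ≤ |h z| → F z = |h z|) ∧
      (∀ z, z ≠ 0 → ‖fderiv ℝ F z‖ ≤ (1 + c * ε) * ‖fderiv ℝ h z‖) ∧
      ∀ z, ε / 2 * ‖z‖ ^ n ≤ F z := by
  have hh' : ∀ c : ℝ, 0 < c → ∀ z, h (c • z) = c ^ n * h z := fun c _ => hh c
  have hgs : ContDiffOn ℝ (⊤ : ℕ∞) (conicCutoff h n δ) {0}ᶜ := contDiffOn_conicCutoff hs hδ.ne'
  have h1 : (1 : WithTop ℕ∞) ≤ ((⊤ : ℕ∞) : WithTop ℕ∞) := by exact_mod_cast le_top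
  obtain ⟨m, hm, hmb⟩ :=
    exists_le_norm_fderiv_of_homogeneous (hs.of_le h1).contDiffOn hh' hd
  obtain ⟨C, hC, hCb⟩ :=
    exists_norm_fderiv_le_of_homogeneous (hgs.of_le h1) (conicCutoff_smul hh')
  refine ⟨C / m, by positivity, fun ε hε hεδ => ?_⟩
  set g := conicCutoff h n δ with hg
  have hg0 : ∀ z, 0 ≤ g z := conicCutoff_nonneg
  have hlow : ∀ z, z ≠ 0 → (ε / 2 * ‖z‖ ^ n) ^ 2 ≤ h z ^ 2 + ε ^ 2 * g z :=
    fun z hz => sq_le_sq_add_conicCutoff hε hεδ.le hz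
  have hpos : ∀ z, z ≠ 0 → 0 < h z ^ 2 + ε ^ 2 * g z :=
    fun z hz => lt_of_lt_of_le (by positivity) (hlow z hz)
  have hFs : ContDiffOn ℝ (⊤ : ℕ∞) (fun z => √(h z ^ 2 + ε ^ 2 * g z)) {0}ᶜ :=
    ((hs.pow 2).contDiffOn.add (contDiffOn_const.mul hgs)).sqrt fun z hz => (hpos z hz).ne'
  refine ⟨fun z => √(h z ^ 2 + ε ^ 2 * g z), ?_, hFs, fun z => ?_, fun z hz hU => ?_,
    fun z hz => ?_, fun z => ?_⟩
  · rw [continuous_iff_continuousAt]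
    intro z
    by_cases hz : z = 0
    · subst hz
      have hgc : ContinuousAt g 0 := by
        have hr : Tendsto (fun z : E => (‖z‖ ^ 2) ^ n) (𝓝 0) (𝓝 0) := by
          have : Continuous fun z : E => (‖z‖ ^ 2) ^ n := by fun_prop
          simpa [hn] using this.tendsto 0
        have hg00 : g 0 = 0 := le_antisymm ((conicCutoff_le 0).trans (by simp [hn])) (hg0 0)
        rw [ContinuousAt, hg00]
        exact squeeze_zero hg0 conicCutoff_le hr
      exact ((hs.continuous.continuousAt.pow 2).add (continuousAt_const.mul hgc)).sqrt
    · exact hFs.continuousOn.continuousAt (isOpen_compl_singleton.mem_nhds hz)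
  · exact Real.abs_le_sqrt (by nlinarith [mul_nonneg (sq_nonneg ε) (hg0 z)])
  · have : g z = 0 := conicCutoff_eq_zero hδ hz hU
    simp [this, Real.sqrt_sq_eq_abs]
  · have hr : 0 < ‖z‖ := norm_pos_iff.mpr hz
    have hdg : DifferentiableAt ℝ g z :=
      (hgs.contDiffAt (isOpen_compl_singleton.mem_nhds hz)).differentiableAt (by simp)
    have hdh : DifferentiableAt ℝ h z := hs.contDiffAt.differentiableAt (by simp)
    refine (norm_fderiv_sqrt_sq_add_le (sq_nonneg ε) hdh hdg (hg0 z) (hpos z hz)).trans ?_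
    have hS : ε / 2 * ‖z‖ ^ n ≤ √(h z ^ 2 + ε ^ 2 * g z) := Real.le_sqrt_of_sq_le (hlow z hz)
    have hR : 0 < ‖z‖ ^ n := by positivity
    have hcoef : ε ^ 2 / (2 * √(h z ^ 2 + ε ^ 2 * g z)) ≤ ε / ‖z‖ ^ n := by
      calc _ ≤ ε ^ 2 / (2 * (ε / 2 * ‖z‖ ^ n)) := by gcongr
        _ = _ := by field_simp
    have hDg : ‖fderiv ℝ g z‖ ≤ C / m * ‖z‖ ^ n * ‖fderiv ℝ h z‖ := by
      refine le_of_mul_le_mul_right ?_ hr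
      calc _ ≤ C * ‖z‖ ^ (2 * n) := hCb z hz
        _ = C / m * ‖z‖ ^ n * (m * ‖z‖ ^ n) := by field_simp; ring
        _ ≤ C / m * ‖z‖ ^ n * (‖fderiv ℝ h z‖ * ‖z‖) := mul_le_mul_of_nonneg_left (hmb z hz) (by positivity)
        _ = _ := by ring
    calc _ ≤ ‖fderiv ℝ h z‖ + ε / ‖z‖ ^ n * (C / m * ‖z‖ ^ n * ‖fderiv ℝ h z‖) := by gcongr
      _ = _ := by field_simp
  · by_cases hz : z = 0
    · simp [hz, hn]
    · exact Real.le_sqrt_of_sq_le (hlow z hz)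

/-- Let `f ∈ ℂ[z₁,…,zₙ]` (n ≥ 2) be a non-degenerate homogeneous
polynomial of degree `n`, fix `ε₁ > 0` and let
`U = {z ≠ 0 : |Re f(z/‖z‖)| ≥ ε₁}` be the corresponding cone.  Then there is a constant
`c = c(n,f,ε₁) > 0` such that for every sufficiently small `ε > 0` there exists
`𝑓̃ : ℂⁿ → ℝ`, continuous on `ℂⁿ` and smooth away from the origin, with
(i) `𝑓̃ ≥ |Re f|` everywhere and `𝑓̃ = |Re f|` on `U`;
(ii) `‖∇𝑓̃(z)‖ ≤ (1 + cε) ‖∇Re f(z)‖` for `z ≠ 0` (real Fréchet derivatives on `ℝ^{2n}`);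
(iii) `𝑓̃(z) ≥ (ε/2) ‖z‖ⁿ`. -/
theorem stmt_15 (n : ℕ) (hn : 2 ≤ n) (f : MvPolynomial (Fin n) ℂ)
    (hf : f.IsHomogeneous n)
    (hnd : ∀ z : Fin n → ℂ, (∀ i, eval z (pderiv i f) = 0) → z = 0)
    (ε₁ : ℝ) (hε₁ : 0 < ε₁)
    (U : Set (EuclideanSpace ℂ (Fin n)))
    (hU : U = {z : EuclideanSpace ℂ (Fin n) | z ≠ 0 ∧
      ε₁ ≤ |(eval (fun i => ((‖z‖⁻¹ : ℝ) • z) i) f).re|}) :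
    ∃ c > (0 : ℝ), ∃ ε₀ > (0 : ℝ), ∀ ε : ℝ, 0 < ε → ε < ε₀ →
      ∃ ftil : EuclideanSpace ℂ (Fin n) → ℝ,
        Continuous ftil ∧
        ContDiffOn ℝ (⊤ : ℕ∞) ftil {(0 : EuclideanSpace ℂ (Fin n))}ᶜ ∧
        (∀ z, |(eval (fun i => z i) f).re| ≤ ftil z) ∧
        (∀ z ∈ U, ftil z = |(eval (fun i => z i) f).re|) ∧
        (∀ z : EuclideanSpace ℂ (Fin n), z ≠ 0 →
          ‖fderiv ℝ ftil z‖ ≤ (1 + c * ε) *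
            ‖fderiv ℝ (fun w : EuclideanSpace ℂ (Fin n) =>
              (eval (fun i => w i) f).re) z‖) ∧
        (∀ z : EuclideanSpace ℂ (Fin n), ε / 2 * ‖z‖ ^ n ≤ ftil z) := by
  have hderiv : ∀ z : EuclideanSpace ℂ (Fin n),
      HasFDerivAt (fun w : EuclideanSpace ℂ (Fin n) => (eval (fun i => w i) f).re)
        (Complex.reCLM.comp ((∑ i, eval (fun j => z j) (pderiv i f) •
          EuclideanSpace.proj (𝕜 := ℂ) i : EuclideanSpace ℂ (Fin n) →L[ℂ] ℂ).restrictScalars ℝ))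
        z := fun z =>
    Complex.reCLM.hasFDerivAt.comp z
      ((hasFDerivAt_eval_euclideanSpace f z).restrictScalars ℝ)
  have hsmooth : ContDiff ℝ (⊤ : ℕ∞)
      fun w : EuclideanSpace ℂ (Fin n) => (eval (fun i => w i) f).re := by
    simp only [eval_eq']
    refine Complex.reCLM.contDiff.comp (ContDiff.sum fun d _ => contDiff_const.mul
      (contDiff_prod fun i _ => ContDiff.pow ?_ _))
    exact ((EuclideanSpace.proj (𝕜 := ℂ) i).restrictScalars ℝ).contDiff
  have hhom : ∀ (c : ℝ) (z : EuclideanSpace ℂ (Fin n)),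
      (eval (fun i => (c • z) i) f).re = c ^ n * (eval (fun i => z i) f).re := fun c z => by
    have := hf.eval_const_mul (c : ℂ) (fun i => z i)
    simp only [PiLp.smul_apply, Complex.real_smul, this]
    rw [← Complex.ofReal_pow, Complex.re_ofReal_mul]
  have hne : ∀ z : EuclideanSpace ℂ (Fin n), z ≠ 0 →
      fderiv ℝ (fun w : EuclideanSpace ℂ (Fin n) => (eval (fun i => w i) f).re) z ≠ 0 := by
    intro z hz h0
    rw [(hderiv z).fderiv] at h0
    have hval : ∀ i (a : ℂ), (eval (fun j => z j) (pderiv i f) * a).re = 0 := fun i a => by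
      simpa [Pi.single_apply] using DFunLike.congr_fun h0 (EuclideanSpace.single i a)
    have h0z := hnd (fun i => z i) fun i => Complex.ext (by simpa using hval i 1)
      (by simpa using hval i Complex.I)
    exact hz (by ext i; exact congrFun h0z i)
  obtain ⟨c, hc, H⟩ := exists_smoothing_abs_of_homogeneous (by omega) hsmooth hhom hne hε₁
  refine ⟨c, hc, ε₁, hε₁, fun ε hε hlt => ?_⟩
  obtain ⟨F, hF1, hF2, hF3, hF4, hF5, hF6⟩ := H ε hε hlt
  refine ⟨F, hF1, hF2, hF3, fun z hz => ?_, hF5, hF6⟩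
  rw [hU] at hz
  obtain ⟨hz0, hle⟩ := hz
  refine hF4 z hz0 ?_
  have hr : 0 < ‖z‖ := norm_pos_iff.mpr hz0
  rwa [hhom, abs_mul, abs_of_pos (by positivity), inv_pow, inv_mul_eq_div,
    le_div_iff₀ (by positivity)] at hle

end
end
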